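/- (Extremals for the dual multilinear Hardy–Littlewood–Sobolev inequality.) Let m,n ≥ 1, 0 < α_k < n, α = Σ α_k with (m−1)n < α < mn, q = 2n/(mn−α), p = q/(q−1), and let G_α = π^{mn/2 + n/q} · Π_{k=1}^m [Γ(α_k/4)² Γ((n−α_k)/2) / (Γ((2n−α_k)/4)² Γ(α_k/2))] · [Γ(n/p − n/2)/Γ(n/p)] · [Γ(n)/Γ(n/2)]^{2/p − 1}. Then the function g(x) = (1+|x|²)^{−n/p} attains equality: ∫_{(ℝ^n)^m} (∫_{ℝ^n} Π_{k=1}^m |y_k−x|^{−(n−α_k/2)} g(x) dx)² dy_1⋯dy_m = G_α · (∫_{ℝ^n} g(x)^p dx)^{2/p}, with both sides finite. -/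

import Mathlib

open MeasureTheory Real
open scoped ENNReal

noncomputable section

/-- The lower Lebesgue integral version of `Γ(s) r^{-s} = ∫ t^{s-1} e^{-rt} dt`. -/
theorem lintegral_rpow_mul_exp_neg_mul_Ioi {s r : ℝ} (hs : 0 < s) (hr : 0 < r) :
    ∫⁻ t in Set.Ioi (0 : ℝ), ENNReal.ofReal (t ^ (s - 1) * exp (-(r * t))) =
      ENNReal.ofReal (Gamma s * r ^ (-s)) := by
  have hval := integral_rpow_mul_exp_neg_mul_Ioi hs hr
  have hint : IntegrableOn (fun t : ℝ => t ^ (s - 1) * exp (-(r * t))) (Set.Ioi 0) := by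
    by_contra h
    rw [integral_undef h] at hval
    have := Gamma_pos_of_pos hs
    have : 0 < (1 / r) ^ s * Gamma s := by positivity
    linarith
  rw [← ofReal_integral_eq_lintegral_ofReal hint, hval, one_div, inv_rpow hr.le, rpow_neg hr.le,
    mul_comm]
  filter_upwards [ae_restrict_mem measurableSet_Ioi] with t ht
  have : (0 : ℝ) < t := ht
  positivity

theorem lintegral_Ioi_comp_mul_left {w : ℝ} (hw : 0 < w) (f : ℝ → ℝ≥0∞) :
    ∫⁻ t in Set.Ioi (0 : ℝ), f t = ENNReal.ofReal w * ∫⁻ v in Set.Ioi (0 : ℝ), f (w * v) := by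
  have himg : (fun v : ℝ => w * v) '' Set.Ioi 0 = Set.Ioi 0 := by
    simp [Set.image_mul_left_Ioi hw]
  rw [← lintegral_const_mul' _ _ ENNReal.ofReal_ne_top]
  conv_lhs => rw [← himg]
  rw [lintegral_image_eq_lintegral_abs_deriv_mul (f' := fun _ => w) measurableSet_Ioi
    (fun x _ => by simpa using ((hasDerivAt_id x).const_mul w).hasDerivWithinAt)
    (mul_right_injective₀ hw.ne').injOn, abs_of_pos hw]

/-- The Beta integral on the half-line, rescaled. -/
theorem lintegral_rpow_mul_add_mul_rpow {a b A B : ℝ} (ha : 0 < a) (hb : 0 < b) (hA : 0 < A)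
    (hB : 0 < B) :
    ∫⁻ v in Set.Ioi (0 : ℝ), ENNReal.ofReal (v ^ (a - 1) * (A + B * v) ^ (-(a + b))) =
      ENNReal.ofReal (Gamma a * Gamma b / Gamma (a + b) * (B ^ (-a) * A ^ (-b))) := by
  have hab : 0 < a + b := by positivity
  have hGa := Gamma_pos_of_pos ha
  have hGb := Gamma_pos_of_pos hb
  have hGab := Gamma_pos_of_pos hab
  have hswap : ∫⁻ v in Set.Ioi (0 : ℝ), ∫⁻ w in Set.Ioi (0 : ℝ),
        ENNReal.ofReal (v ^ (a - 1) * (w ^ (a + b - 1) * exp (-((A + B * v) * w)))) =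
      ∫⁻ w in Set.Ioi (0 : ℝ), ∫⁻ v in Set.Ioi (0 : ℝ),
        ENNReal.ofReal (v ^ (a - 1) * (w ^ (a + b - 1) * exp (-((A + B * v) * w)))) :=
    lintegral_lintegral_swap (by fun_prop)
  have hleft : ∫⁻ v in Set.Ioi (0 : ℝ), ∫⁻ w in Set.Ioi (0 : ℝ),
        ENNReal.ofReal (v ^ (a - 1) * (w ^ (a + b - 1) * exp (-((A + B * v) * w)))) =
      ENNReal.ofReal (Gamma (a + b)) * ∫⁻ v in Set.Ioi (0 : ℝ),
        ENNReal.ofReal (v ^ (a - 1) * (A + B * v) ^ (-(a + b))) := by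
    rw [← lintegral_const_mul' _ _ ENNReal.ofReal_ne_top]
    refine setLIntegral_congr_fun measurableSet_Ioi fun v (hv : 0 < v) => ?_
    simp only [ENNReal.ofReal_mul (rpow_nonneg hv.le _)]
    rw [lintegral_const_mul' _ _ ENNReal.ofReal_ne_top,
      lintegral_rpow_mul_exp_neg_mul_Ioi hab (by positivity), ENNReal.ofReal_mul hGab.le]
    ring
  have hright : ∫⁻ w in Set.Ioi (0 : ℝ), ∫⁻ v in Set.Ioi (0 : ℝ),
        ENNReal.ofReal (v ^ (a - 1) * (w ^ (a + b - 1) * exp (-((A + B * v) * w)))) =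
      ENNReal.ofReal (Gamma a * B ^ (-a)) * ENNReal.ofReal (Gamma b * A ^ (-b)) := by
    rw [← lintegral_rpow_mul_exp_neg_mul_Ioi hb hA,
      ← lintegral_const_mul' _ _ ENNReal.ofReal_ne_top]
    refine setLIntegral_congr_fun measurableSet_Ioi fun w (hw : 0 < w) => ?_
    have hfactor : ∀ v : ℝ, v ^ (a - 1) * (w ^ (a + b - 1) * exp (-((A + B * v) * w))) =
        (w ^ (a + b - 1) * exp (-(A * w))) * (v ^ (a - 1) * exp (-((B * w) * v))) := by
      intro v
      rw [show -((A + B * v) * w) = -(A * w) + -((B * w) * v) by ring, exp_add]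
      ring
    have hnonneg : 0 ≤ w ^ (a + b - 1) * exp (-(A * w)) := by positivity
    simp only [hfactor, ENNReal.ofReal_mul hnonneg]
    rw [lintegral_const_mul' _ _ ENNReal.ofReal_ne_top,
      lintegral_rpow_mul_exp_neg_mul_Ioi ha (by positivity), ← ENNReal.ofReal_mul hnonneg,
      ← ENNReal.ofReal_mul (by positivity), mul_rpow hB.le hw.le,
      show a + b - 1 = b - 1 + a by ring, rpow_add hw, rpow_neg hw.le]
    congr 1
    field_simp
  rw [hleft, hright, ← ENNReal.ofReal_mul (by positivity)] at hswap
  have hne : ENNReal.ofReal (Gamma (a + b)) ≠ 0 := by simpa using hGab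
  rw [← ENNReal.mul_right_inj hne ENNReal.ofReal_ne_top, hswap, ← ENNReal.ofReal_mul hGab.le]
  congr 1
  field_simp

theorem mul_norm_sub_sq_add_mul_norm_sub_sq {E : Type*} [NormedAddCommGroup E]
    [InnerProductSpace ℝ E] {t w : ℝ} (h : t + w ≠ 0) (x x' y : E) :
    t * ‖y - x‖ ^ 2 + w * ‖y - x'‖ ^ 2 =
      (t + w) * ‖y - (t + w)⁻¹ • (t • x + w • x')‖ ^ 2 + t * w / (t + w) * ‖x - x'‖ ^ 2 := by
  simp only [norm_sub_sq_real, norm_smul, inner_smul_right, inner_add_right, mul_pow,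
    norm_add_sq_real, inner_smul_left, norm_eq_abs, sq_abs, conj_trivial]
  field_simp
  ring

variable {n : ℕ}

theorem lintegral_exp_neg_mul_norm_sub_sq {b : ℝ} (hb : 0 < b) (c : EuclideanSpace ℝ (Fin n)) :
    ∫⁻ y : EuclideanSpace ℝ (Fin n), ENNReal.ofReal (exp (-(b * ‖y - c‖ ^ 2))) =
      ENNReal.ofReal ((π / b) ^ ((n : ℝ) / 2)) := by
  rw [lintegral_sub_right_eq_self
    (fun y : EuclideanSpace ℝ (Fin n) => ENNReal.ofReal (exp (-(b * ‖y‖ ^ 2)))) c]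
  have hval := GaussianFourier.integral_rexp_neg_mul_sq_norm
    (V := EuclideanSpace ℝ (Fin n)) hb
  simp only [finrank_euclideanSpace, Fintype.card_fin, neg_mul] at hval
  have hint : Integrable fun y : EuclideanSpace ℝ (Fin n) => exp (-(b * ‖y‖ ^ 2)) := by
    by_contra h
    rw [integral_undef h] at hval
    have : 0 < (π / b) ^ ((n : ℝ) / 2) := by positivity
    linarith
  rw [← ofReal_integral_eq_lintegral_ofReal hint (ae_of_all _ fun _ => (exp_pos _).le), hval]

theorem lintegral_fin_prod_eq_prod {X : Type*} [MeasureSpace X] [SigmaFinite (volume : Measure X)] :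
    ∀ {m : ℕ} {f : Fin m → X → ℝ≥0∞}, (∀ k, Measurable (f k)) →
      ∫⁻ y : Fin m → X, ∏ k, f k (y k) = ∏ k, ∫⁻ x, f k x := by
  intro m
  induction m with
  | zero => intro f _; simp [volume_pi]
  | succ m ih =>
    intro f hf
    rw [← ((volume_preserving_piFinSuccAbove (fun _ => X) 0).symm).lintegral_comp
      (by fun_prop)]
    simp only [Fin.prod_univ_succ, ← ih fun k => hf k.succ]
    rw [← lintegral_prod_mul (hf 0).aemeasurable
      (Finset.measurable_prod _ fun k _ => (hf k.succ).comp (measurable_pi_apply k)).aemeasurable]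
    simp [MeasurableEquiv.piFinSuccAbove, Fin.insertNthEquiv, Measure.volume_eq_prod]

theorem lintegral_exp_neg_mul_norm_sub_sq_add {t w : ℝ} (h : 0 < t + w)
    (x x' : EuclideanSpace ℝ (Fin n)) :
    ∫⁻ y, ENNReal.ofReal (exp (-(t * ‖y - x‖ ^ 2 + w * ‖y - x'‖ ^ 2))) =
      ENNReal.ofReal ((π / (t + w)) ^ ((n : ℝ) / 2) *
        exp (-(t * w / (t + w) * ‖x - x'‖ ^ 2))) := by
  simp only [mul_norm_sub_sq_add_mul_norm_sub_sq h.ne' x x', neg_add, exp_add,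
    ENNReal.ofReal_mul (exp_pos _).le]
  rw [lintegral_mul_const' _ _ ENNReal.ofReal_ne_top, lintegral_exp_neg_mul_norm_sub_sq h,
    ← ENNReal.ofReal_mul (by positivity)]

/-- The integral of a product of two powers of (regularised) squared distances, reduced to a
one-dimensional integral by writing both powers as superpositions of Gaussians. -/
theorem lintegral_rpow_norm_sub_sq_mul_rpow (hn : 1 ≤ n) {s u B : ℝ} (hs : 0 < s) (hu : 0 < u)
    (hsu : (n : ℝ) / 2 < s + u) (hB : 0 ≤ B) {x x' : EuclideanSpace ℝ (Fin n)}
    (hpos : 0 < B + ‖x - x'‖ ^ 2) :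
    ENNReal.ofReal (Gamma s * Gamma u) *
        ∫⁻ y, ENNReal.ofReal ((‖y - x‖ ^ 2) ^ (-s)) *
          ENNReal.ofReal ((B + ‖y - x'‖ ^ 2) ^ (-u)) =
      ENNReal.ofReal (π ^ ((n : ℝ) / 2) * Gamma (s + u - n / 2)) *
        ∫⁻ v in Set.Ioi (0 : ℝ), ENNReal.ofReal (v ^ (s - 1) * (1 + v) ^ (s + u - n) *
          (B + (B + ‖x - x'‖ ^ 2) * v) ^ (-(s + u - n / 2))) := by
  have : Nonempty (Fin n) := ⟨⟨0, hn⟩⟩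
  have hGs := Gamma_pos_of_pos hs
  have hGu := Gamma_pos_of_pos hu
  set D := ‖x - x'‖ ^ 2 with hD
  have hD0 : 0 ≤ D := by positivity
  set F : EuclideanSpace ℝ (Fin n) → ℝ → ℝ → ℝ≥0∞ := fun y w t =>
    ENNReal.ofReal (t ^ (s - 1)) * ENNReal.ofReal (w ^ (u - 1) * exp (-(w * B))) *
      ENNReal.ofReal (exp (-(t * ‖y - x‖ ^ 2 + w * ‖y - x'‖ ^ 2))) with hF
  have hleft : ENNReal.ofReal (Gamma s * Gamma u) *
        ∫⁻ y, ENNReal.ofReal ((‖y - x‖ ^ 2) ^ (-s)) *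
          ENNReal.ofReal ((B + ‖y - x'‖ ^ 2) ^ (-u)) =
      ∫⁻ y, ∫⁻ w in Set.Ioi (0 : ℝ), ∫⁻ t in Set.Ioi (0 : ℝ), F y w t := by
    rw [← lintegral_const_mul' _ _ ENNReal.ofReal_ne_top]
    refine lintegral_congr_ae ?_
    filter_upwards [Measure.ae_ne volume x, Measure.ae_ne volume x'] with y hyx hyx'
    have h1 : 0 < ‖y - x‖ ^ 2 := pow_pos (norm_pos_iff.2 (sub_ne_zero.2 hyx)) 2
    have h2 : 0 < B + ‖y - x'‖ ^ 2 :=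
      add_pos_of_nonneg_of_pos hB (pow_pos (norm_pos_iff.2 (sub_ne_zero.2 hyx')) 2)
    calc _ = ENNReal.ofReal (Gamma s * (‖y - x‖ ^ 2) ^ (-s)) *
          ENNReal.ofReal (Gamma u * (B + ‖y - x'‖ ^ 2) ^ (-u)) := by
          rw [ENNReal.ofReal_mul hGs.le, ENNReal.ofReal_mul hGs.le, ENNReal.ofReal_mul hGu.le]
          ring
      _ = _ := by
          rw [← lintegral_rpow_mul_exp_neg_mul_Ioi hs h1, ← lintegral_rpow_mul_exp_neg_mul_Ioi hu h2,
            ← lintegral_const_mul' _ _ (by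
              rw [lintegral_rpow_mul_exp_neg_mul_Ioi hs h1]; exact ENNReal.ofReal_ne_top)]
          refine setLIntegral_congr_fun measurableSet_Ioi fun w (hw : 0 < w) => ?_
          rw [← lintegral_mul_const' _ _ ENNReal.ofReal_ne_top]
          refine setLIntegral_congr_fun measurableSet_Ioi fun t (ht : 0 < t) => ?_
          simp only [hF]
          rw [← ENNReal.ofReal_mul (by positivity), ← ENNReal.ofReal_mul (by positivity),
            ← ENNReal.ofReal_mul (by positivity)]
          congr 1
          rw [show -((B + ‖y - x'‖ ^ 2) * w) = -(w * B) + -(w * ‖y - x'‖ ^ 2) by ring,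
            neg_add, exp_add, exp_add, mul_comm t, mul_comm w (‖y - x'‖ ^ 2)]
          ring
  have hFm : Measurable fun q : (EuclideanSpace ℝ (Fin n) × ℝ) × ℝ => F q.1.1 q.1.2 q.2 := by
    fun_prop
  have hswap : ∫⁻ y, ∫⁻ w in Set.Ioi (0 : ℝ), ∫⁻ t in Set.Ioi (0 : ℝ), F y w t =
      ∫⁻ w in Set.Ioi (0 : ℝ), ∫⁻ t in Set.Ioi (0 : ℝ), ∫⁻ y, F y w t := by
    rw [lintegral_lintegral_swap hFm.lintegral_prod_right'.aemeasurable]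
    refine lintegral_congr fun w => lintegral_lintegral_swap ?_
    exact (hFm.comp (by fun_prop : Measurable fun q : EuclideanSpace ℝ (Fin n) × ℝ =>
      ((q.1, w), q.2))).aemeasurable
  have hscale : ∫⁻ w in Set.Ioi (0 : ℝ), ∫⁻ t in Set.Ioi (0 : ℝ), ∫⁻ y, F y w t =
      ∫⁻ w in Set.Ioi (0 : ℝ), ∫⁻ v in Set.Ioi (0 : ℝ),
        ENNReal.ofReal (π ^ ((n : ℝ) / 2) * (v ^ (s - 1) * (1 + v) ^ (-((n : ℝ) / 2)))) *
          ENNReal.ofReal (w ^ (s + u - n / 2 - 1) * exp (-((B + v * D / (1 + v)) * w))) := by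
    refine setLIntegral_congr_fun measurableSet_Ioi fun w (hw : 0 < w) => ?_
    rw [lintegral_Ioi_comp_mul_left hw, ← lintegral_const_mul' _ _ ENNReal.ofReal_ne_top]
    refine setLIntegral_congr_fun measurableSet_Ioi fun v (hv : 0 < v) => ?_
    simp only [hF]
    rw [lintegral_const_mul' _ _ (ENNReal.mul_ne_top ENNReal.ofReal_ne_top ENNReal.ofReal_ne_top),
      lintegral_exp_neg_mul_norm_sub_sq_add (by positivity), ← hD,
      ← ENNReal.ofReal_mul (by positivity), ← ENNReal.ofReal_mul (by positivity),
      ← ENNReal.ofReal_mul (by positivity), ← ENNReal.ofReal_mul (by positivity)]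
    congr 1
    have hexp : exp (-((B + v * D / (1 + v)) * w)) =
        exp (-(w * B)) * exp (-(w * v * w / (w * v + w) * D)) := by
      rw [← exp_add]
      congr 1
      field_simp
      ring
    have hpow : w ^ (s + u - n / 2 - 1) =
        w * w ^ (s - 1) * w ^ (u - 1) * w ^ (-((n : ℝ) / 2)) := by
      conv_rhs => rw [← rpow_one_add' hw.le (by linarith)]
      rw [← rpow_add hw, ← rpow_add hw]
      ring_nf
    rw [hexp, hpow, mul_rpow hw.le hv.le, show w * v + w = w * (1 + v) by ring,
      div_rpow pi_pos.le (by positivity), mul_rpow hw.le (by positivity), rpow_neg hw.le,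
      rpow_neg (by positivity : 0 ≤ 1 + v)]
    field_simp
  rw [hleft, hswap, hscale, lintegral_lintegral_swap (by fun_prop),
    ← lintegral_const_mul' _ _ ENNReal.ofReal_ne_top]
  refine setLIntegral_congr_fun measurableSet_Ioi fun v (hv : 0 < v) => ?_
  have hbase : 0 < B + (B + D) * v := add_pos_of_nonneg_of_pos hB (mul_pos hpos hv)
  have hdiv : B + v * D / (1 + v) = (B + (B + D) * v) / (1 + v) := by
    field_simp
    ring
  have hσ : 0 < s + u - n / 2 := by linarith
  have hGσ := Gamma_pos_of_pos hσ
  rw [lintegral_const_mul' _ _ ENNReal.ofReal_ne_top,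
    lintegral_rpow_mul_exp_neg_mul_Ioi hσ (by rw [hdiv]; positivity),
    ← ENNReal.ofReal_mul (by positivity), ← ENNReal.ofReal_mul (by positivity), hdiv,
    div_rpow hbase.le (by positivity), show s + u - n = -((n : ℝ) / 2) + (s + u - n / 2) by ring,
    rpow_add (by positivity : 0 < 1 + v), rpow_neg (by positivity : 0 ≤ 1 + v) (s + u - n / 2)]
  congr 1
  field_simp

/-- The composition formula for Riesz kernels. -/
theorem lintegral_norm_sub_rpow_mul_norm_sub_rpow (hn : 1 ≤ n) {a : ℝ} (ha : 0 < a)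
    (han : a < n) {x x' : EuclideanSpace ℝ (Fin n)} (hx : x ≠ x') :
    ∫⁻ y, ENNReal.ofReal (‖y - x‖ ^ (a / 2 - n)) * ENNReal.ofReal (‖y - x'‖ ^ (a / 2 - n)) =
      ENNReal.ofReal (π ^ ((n : ℝ) / 2) * (Gamma (a / 4) ^ 2 * Gamma (((n : ℝ) - a) / 2) /
        (Gamma ((2 * (n : ℝ) - a) / 4) ^ 2 * Gamma (a / 2)))) *
      ENNReal.ofReal (‖x - x'‖ ^ (a - n)) := by
  have hs : 0 < (2 * (n : ℝ) - a) / 4 := by linarith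
  have hnorm : 0 < ‖x - x'‖ := norm_pos_iff.2 (sub_ne_zero.2 hx)
  have hG1 := Gamma_pos_of_pos hs
  have hG2 := Gamma_pos_of_pos (show 0 < a / 4 by linarith)
  have hG3 := Gamma_pos_of_pos (show 0 < ((n : ℝ) - a) / 2 by linarith)
  have hG4 := Gamma_pos_of_pos (show 0 < a / 2 by linarith)
  have hsq : ∀ z : EuclideanSpace ℝ (Fin n),
      ‖z‖ ^ (a / 2 - n) = (‖z‖ ^ 2) ^ (-((2 * (n : ℝ) - a) / 4)) := by
    intro z
    rw [← rpow_natCast, ← rpow_mul (norm_nonneg z)]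
    congr 1
    push_cast
    ring
  have key := lintegral_rpow_norm_sub_sq_mul_rpow hn hs hs (by linarith) le_rfl
    (x := x) (x' := x') (by positivity)
  have hbeta := lintegral_rpow_mul_add_mul_rpow (show 0 < a / 4 by linarith)
    (show 0 < a / 4 by linarith) one_pos one_pos
  have hcongr : ∫⁻ v in Set.Ioi (0 : ℝ), ENNReal.ofReal (v ^ ((2 * (n : ℝ) - a) / 4 - 1) *
        (1 + v) ^ ((2 * (n : ℝ) - a) / 4 + (2 * (n : ℝ) - a) / 4 - n) *
          (0 + (0 + ‖x - x'‖ ^ 2) * v) ^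
            (-((2 * (n : ℝ) - a) / 4 + (2 * (n : ℝ) - a) / 4 - n / 2))) =
      ENNReal.ofReal (‖x - x'‖ ^ (a - n)) * ∫⁻ v in Set.Ioi (0 : ℝ),
        ENNReal.ofReal (v ^ (a / 4 - 1) * (1 + 1 * v) ^ (-(a / 4 + a / 4))) := by
    rw [← lintegral_const_mul' _ _ ENNReal.ofReal_ne_top]
    refine setLIntegral_congr_fun measurableSet_Ioi fun v (hv : 0 < v) => ?_
    rw [← ENNReal.ofReal_mul (by positivity), zero_add, zero_add,
      mul_rpow (by positivity) hv.le, ← rpow_natCast, ← rpow_mul hnorm.le, one_mul,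
      show a / 4 - 1 = (2 * (n : ℝ) - a) / 4 - 1 +
        (-((2 * (n : ℝ) - a) / 4 + (2 * (n : ℝ) - a) / 4 - n / 2)) by ring, rpow_add hv]
    congr 1
    rw [show ((2 : ℕ) : ℝ) * -((2 * (n : ℝ) - a) / 4 + (2 * (n : ℝ) - a) / 4 - n / 2) = a - n by
        push_cast; ring,
      show (2 * (n : ℝ) - a) / 4 + (2 * (n : ℝ) - a) / 4 - n = -(a / 4 + a / 4) by ring]
    ring
  have hne : ENNReal.ofReal (Gamma ((2 * (n : ℝ) - a) / 4) * Gamma ((2 * (n : ℝ) - a) / 4)) ≠ 0 := by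
    simpa using mul_pos hG1 hG1
  simp only [hsq (_ - x), hsq (_ - x')]
  rw [hcongr, hbeta] at key
  simp only [zero_add] at key
  rw [← ENNReal.mul_right_inj hne ENNReal.ofReal_ne_top, key,
    show (2 * (n : ℝ) - a) / 4 + (2 * (n : ℝ) - a) / 4 - n / 2 = ((n : ℝ) - a) / 2 by ring,
    show a / 4 + a / 4 = a / 2 by ring, one_rpow,
    ← ENNReal.ofReal_mul (by positivity), ← ENNReal.ofReal_mul (by positivity),
    ← ENNReal.ofReal_mul (by positivity), ← ENNReal.ofReal_mul (by positivity)]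
  congr 1
  generalize Gamma ((2 * (n : ℝ) - a) / 4) = c at hG1 ⊢
  field_simp

/-- The conformal factor `(1 + |y|²)^{s-n}` has an explicit Riesz potential. -/
theorem lintegral_norm_sub_rpow_mul_one_add_norm_sq_rpow (hn : 1 ≤ n) {s : ℝ} (hs : 0 < s)
    (hsn : s < n / 2) (x : EuclideanSpace ℝ (Fin n)) :
    ∫⁻ y, ENNReal.ofReal ((‖y - x‖ ^ 2) ^ (-s)) * ENNReal.ofReal ((1 + ‖y‖ ^ 2) ^ (s - n)) =
      ENNReal.ofReal (π ^ ((n : ℝ) / 2) * (Gamma (n / 2 - s) / Gamma (n - s))) *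
        ENNReal.ofReal ((1 + ‖x‖ ^ 2) ^ (-s)) := by
  have hGs := Gamma_pos_of_pos hs
  have hG1 := Gamma_pos_of_pos (show 0 < (n : ℝ) / 2 - s by linarith)
  have hG2 := Gamma_pos_of_pos (show 0 < (n : ℝ) - s by linarith)
  have hG3 := Gamma_pos_of_pos (show 0 < (n : ℝ) / 2 by linarith)
  have key := lintegral_rpow_norm_sub_sq_mul_rpow hn hs (show 0 < (n : ℝ) - s by linarith)
    (by linarith) zero_le_one (x := x) (x' := 0) (by positivity)
  have hbeta := lintegral_rpow_mul_add_mul_rpow hs (show 0 < (n : ℝ) / 2 - s by linarith)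
    one_pos (show 0 < 1 + ‖x‖ ^ 2 by positivity)
  simp only [sub_zero, add_sub_cancel, sub_self, rpow_zero, mul_one, neg_sub, one_rpow,
    show (n : ℝ) - n / 2 = n / 2 by ring] at key hbeta
  rw [hbeta] at key
  have hne : ENNReal.ofReal (Gamma s * Gamma (n - s)) ≠ 0 := by
    simpa using mul_pos hGs hG2
  rw [← ENNReal.mul_right_inj hne ENNReal.ofReal_ne_top, key, ← ENNReal.ofReal_mul (by positivity),
    ← ENNReal.ofReal_mul (by positivity), ← ENNReal.ofReal_mul (by positivity)]
  congr 1
  field_simp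

theorem lintegral_one_add_norm_sq_rpow {u : ℝ} (hu : (n : ℝ) / 2 < u) :
    ∫⁻ y : EuclideanSpace ℝ (Fin n), ENNReal.ofReal ((1 + ‖y‖ ^ 2) ^ (-u)) =
      ENNReal.ofReal (π ^ ((n : ℝ) / 2) * (Gamma (u - n / 2) / Gamma u)) := by
  have hu0 : 0 < u := lt_of_le_of_lt (by positivity) hu
  have hGu := Gamma_pos_of_pos hu0
  have hσ : 0 < u - n / 2 := by linarith
  have hGσ := Gamma_pos_of_pos hσ
  have hne : ENNReal.ofReal (Gamma u) ≠ 0 := by simpa using hGu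
  rw [← ENNReal.mul_right_inj hne ENNReal.ofReal_ne_top, ← ENNReal.ofReal_mul hGu.le,
    ← lintegral_const_mul' _ _ ENNReal.ofReal_ne_top]
  have hgamma : ∀ y : EuclideanSpace ℝ (Fin n),
      ENNReal.ofReal (Gamma u) * ENNReal.ofReal ((1 + ‖y‖ ^ 2) ^ (-u)) =
        ∫⁻ w in Set.Ioi (0 : ℝ), ENNReal.ofReal (w ^ (u - 1) * exp (-((1 + ‖y‖ ^ 2) * w))) := by
    intro y
    rw [lintegral_rpow_mul_exp_neg_mul_Ioi hu0 (by positivity), ENNReal.ofReal_mul hGu.le]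
  simp only [hgamma]
  rw [lintegral_lintegral_swap (by fun_prop)]
  have hinner : ∀ w ∈ Set.Ioi (0 : ℝ), ∫⁻ y : EuclideanSpace ℝ (Fin n),
      ENNReal.ofReal (w ^ (u - 1) * exp (-((1 + ‖y‖ ^ 2) * w))) =
        ENNReal.ofReal (π ^ ((n : ℝ) / 2)) *
          ENNReal.ofReal (w ^ (u - n / 2 - 1) * exp (-(1 * w))) := by
    intro w (hw : 0 < w)
    have hsplit : ∀ y : EuclideanSpace ℝ (Fin n), w ^ (u - 1) * exp (-((1 + ‖y‖ ^ 2) * w)) =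
        (w ^ (u - 1) * exp (-w)) * exp (-(w * ‖y - 0‖ ^ 2)) := by
      intro y
      rw [mul_assoc, ← exp_add, sub_zero]
      ring_nf
    have hnonneg : 0 ≤ w ^ (u - 1) * exp (-w) := by positivity
    simp only [hsplit, ENNReal.ofReal_mul hnonneg]
    rw [lintegral_const_mul' _ _ ENNReal.ofReal_ne_top, lintegral_exp_neg_mul_norm_sub_sq hw,
      ← ENNReal.ofReal_mul hnonneg, ← ENNReal.ofReal_mul (by positivity),
      show u - n / 2 - 1 = u - 1 - n / 2 by ring, rpow_sub hw (u - 1), div_rpow pi_pos.le hw.le, one_mul]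
    congr 1
    ring
  rw [setLIntegral_congr_fun measurableSet_Ioi hinner,
    lintegral_const_mul' _ _ ENNReal.ofReal_ne_top, lintegral_rpow_mul_exp_neg_mul_Ioi hσ one_pos,
    ← ENNReal.ofReal_mul (by positivity), one_rpow]
  congr 1
  field_simp


/-- Expanding the square of a multilinear potential and integrating out `y`. -/
theorem lintegral_sq_lintegral_prod_mul {X : Type*} [MeasureSpace X]
    [SigmaFinite (volume : Measure X)] {m : ℕ} {K : Fin m → X → X → ℝ≥0∞}
    (hK : ∀ k, Measurable fun q : X × X => K k q.1 q.2) {f : X → ℝ≥0∞} (hf : Measurable f) :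
    ∫⁻ y : Fin m → X, (∫⁻ x : X, (∏ k, K k (y k) x) * f x) ^ (2 : ℕ) =
      ∫⁻ x, ∫⁻ x', f x * f x' * ∏ k, ∫⁻ z, K k z x * K k z x' := by
  obtain ⟨P, hPdef⟩ : ∃ P : (Fin m → X) → X → ℝ≥0∞, ∀ y x, P y x = (∏ k, K k (y k) x) * f x :=
    ⟨_, fun _ _ => rfl⟩
  have hP : Measurable fun q : (Fin m → X) × X => P q.1 q.2 := by
    simp only [hPdef]
    refine Measurable.mul (Finset.measurable_prod _ fun k _ => ?_) (hf.comp measurable_snd)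
    exact (hK k).comp (f := fun q : (Fin m → X) × X => (q.1 k, q.2))
      (((measurable_pi_apply k).comp measurable_fst).prodMk measurable_snd)
  have hPy : ∀ y, Measurable (P y) := fun y => hP.comp measurable_prodMk_left
  have hPx : ∀ x, Measurable fun y => P y x := fun x => hP.comp measurable_prodMk_right
  calc _ = ∫⁻ y, ∫⁻ x, ∫⁻ x', P y x * P y x' := by
        refine lintegral_congr fun y => ?_
        simp only [← hPdef]
        rw [sq, ← lintegral_mul_const _ (hPy y)]
        exact lintegral_congr fun x => (lintegral_const_mul _ (hPy y)).symm
    _ = ∫⁻ x, ∫⁻ y, ∫⁻ x', P y x * P y x' := by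
        refine lintegral_lintegral_swap (Measurable.aemeasurable ?_)
        simp only [Function.uncurry_def, lintegral_const_mul _ (hPy _)]
        exact hP.mul (hP.lintegral_prod_right'.comp measurable_fst)
    _ = ∫⁻ x, ∫⁻ x', ∫⁻ y, P y x * P y x' := by
        refine lintegral_congr fun x => lintegral_lintegral_swap (Measurable.aemeasurable ?_)
        exact ((hPx x).comp measurable_fst).mul hP
    _ = _ := by
        refine lintegral_congr fun x => lintegral_congr fun x' => ?_
        have hKK : ∀ k, Measurable fun z => K k z x * K k z x' := fun k =>
          ((hK k).comp measurable_prodMk_right).mul ((hK k).comp measurable_prodMk_right)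
        have hprod : Measurable fun y : Fin m → X => ∏ k, K k (y k) x * K k (y k) x' :=
          Finset.measurable_prod _ fun k _ => (hKK k).comp (measurable_pi_apply k)
        rw [← lintegral_fin_prod_eq_prod hKK, ← lintegral_const_mul _ hprod]
        refine lintegral_congr fun y => ?_
        rw [hPdef, hPdef, Finset.prod_mul_distrib]
        ring

/-- **Extremals for the dual multilinear Hardy–Littlewood–Sobolev inequality.**
With `g(x) = (1+|x|²)^{−n/p}`, equality holds in the dual multilinear HLS inequality,
and both sides are finite. -/
theorem stmt10 (m n : ℕ) (hm : 1 ≤ m) (hn : 1 ≤ n)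
    (α : Fin m → ℝ) (hα : ∀ k, 0 < α k ∧ α k < n)
    (hlow : ((m : ℝ) - 1) * n < ∑ k, α k) (hhigh : (∑ k, α k) < m * n)
    (q p : ℝ) (hq : q = 2 * n / ((m : ℝ) * n - ∑ k, α k)) (hp : p = q / (q - 1))
    (Gα : ℝ)
    (hGα : Gα = Real.pi ^ ((m : ℝ) * n / 2 + (n : ℝ) / q) *
      (∏ k, Real.Gamma (α k / 4) ^ 2 * Real.Gamma (((n : ℝ) - α k) / 2) /
        (Real.Gamma ((2 * (n : ℝ) - α k) / 4) ^ 2 * Real.Gamma (α k / 2))) *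
      (Real.Gamma ((n : ℝ) / p - (n : ℝ) / 2) / Real.Gamma ((n : ℝ) / p)) *
      (Real.Gamma (n : ℝ) / Real.Gamma ((n : ℝ) / 2)) ^ (2 / p - 1))
    (g : EuclideanSpace ℝ (Fin n) → ℝ)
    (hg : ∀ x, g x = (1 + ‖x‖ ^ 2) ^ (-(n : ℝ) / p)) :
    (∫⁻ y : Fin m → EuclideanSpace ℝ (Fin n),
        (∫⁻ x : EuclideanSpace ℝ (Fin n),
          (∏ k, ENNReal.ofReal (‖y k - x‖ ^ (α k / 2 - n))) * ENNReal.ofReal (g x)) ^ (2 : ℕ)) =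
      ENNReal.ofReal Gα * (∫⁻ x, ENNReal.ofReal (g x) ^ p) ^ (2 / p) ∧
    ENNReal.ofReal Gα * (∫⁻ x, ENNReal.ofReal (g x) ^ p) ^ (2 / p) ≠ ⊤ := by
  have hn' : (0 : ℝ) < n := by exact_mod_cast hn
  have : Nonempty (Fin n) := ⟨⟨0, hn⟩⟩
  obtain ⟨s, hsdef⟩ : ∃ s : ℝ, s = ((m : ℝ) * n - ∑ k, α k) / 2 := ⟨_, rfl⟩
  have hs : 0 < s := by linarith
  have hsn : s < n / 2 := by linarith
  have hns : 0 < (n : ℝ) - s := by linarith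
  have hq' : q = n / s := by
    rw [hq, show (m : ℝ) * n - ∑ k, α k = 2 * s by linarith]
    field_simp
  have hp' : p = n / (n - s) := by
    rw [hp, hq']
    field_simp
  have hnq : (n : ℝ) / q = s := by rw [hq']; field_simp
  have hnp : (n : ℝ) / p = n - s := by rw [hp']; field_simp
  have hg' : ∀ x, g x = (1 + ‖x‖ ^ 2) ^ (s - n) := by
    intro x
    rw [hg, neg_div, hnp, neg_sub]
  have hGn := Gamma_pos_of_pos hn'
  have hGn2 := Gamma_pos_of_pos (half_pos hn')
  have hGs := Gamma_pos_of_pos (show 0 < (n : ℝ) / 2 - s by linarith)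
  have hGns := Gamma_pos_of_pos hns
  have hS : ∫⁻ x : EuclideanSpace ℝ (Fin n), ENNReal.ofReal ((1 + ‖x‖ ^ 2) ^ (-(n : ℝ))) =
      ENNReal.ofReal (π ^ ((n : ℝ) / 2) * (Gamma (n / 2) / Gamma n)) := by
    rw [lintegral_one_add_norm_sq_rpow (by linarith), sub_half]
  have hgp : ∫⁻ x, ENNReal.ofReal (g x) ^ p =
      ENNReal.ofReal (π ^ ((n : ℝ) / 2) * (Gamma (n / 2) / Gamma n)) := by
    rw [← hS]
    refine lintegral_congr fun x => ?_
    have hx : 0 < 1 + ‖x‖ ^ 2 := by positivity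
    rw [hg', ENNReal.ofReal_rpow_of_pos (by positivity), ← rpow_mul hx.le, hp']
    congr 2
    field_simp
    ring
  rw [hgp, ENNReal.ofReal_rpow_of_pos (by positivity)]
  refine ⟨?_, ENNReal.mul_ne_top ENNReal.ofReal_ne_top ENNReal.ofReal_ne_top⟩
  have hgm : Measurable g := by
    rw [funext hg']
    fun_prop
  rw [lintegral_sq_lintegral_prod_mul (K := fun k z x => ENNReal.ofReal (‖z - x‖ ^ (α k / 2 - n)))
    (fun k => by fun_prop) (hgm.ennreal_ofReal)]
  set c : Fin m → ℝ := fun k => Gamma (α k / 4) ^ 2 * Gamma (((n : ℝ) - α k) / 2) /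
        (Gamma ((2 * (n : ℝ) - α k) / 4) ^ 2 * Gamma (α k / 2)) with hc
  have hc0 : ∀ k, 0 < c k := by
    intro k
    obtain ⟨h1, h2⟩ := hα k
    have := Gamma_pos_of_pos (show 0 < α k / 4 by linarith)
    have := Gamma_pos_of_pos (show 0 < α k / 2 by linarith)
    have := Gamma_pos_of_pos (show 0 < ((n : ℝ) - α k) / 2 by linarith)
    have := Gamma_pos_of_pos (show 0 < (2 * (n : ℝ) - α k) / 4 by linarith)
    positivity
  have hprod0 : 0 < ∏ k, c k := Finset.prod_pos fun k _ => hc0 k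
  have hkernel : ∀ x x' : EuclideanSpace ℝ (Fin n), x' ≠ x →
      ∏ k, ∫⁻ z, ENNReal.ofReal (‖z - x‖ ^ (α k / 2 - n)) *
        ENNReal.ofReal (‖z - x'‖ ^ (α k / 2 - n)) =
      ENNReal.ofReal (π ^ ((m : ℝ) * n / 2) * ∏ k, c k) *
        ENNReal.ofReal ((‖x' - x‖ ^ 2) ^ (-s)) := by
    intro x x' hx
    have hnorm : 0 < ‖x' - x‖ := norm_pos_iff.2 (sub_ne_zero.2 hx)
    rw [Finset.prod_congr rfl fun k _ =>
      lintegral_norm_sub_rpow_mul_norm_sub_rpow hn (hα k).1 (hα k).2 hx.symm,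
      Finset.prod_mul_distrib, ← ENNReal.ofReal_prod_of_nonneg, ← ENNReal.ofReal_prod_of_nonneg,
      Finset.prod_mul_distrib, norm_sub_rev x x', ← rpow_sum_of_pos hnorm]
    · congr 2
      · rw [Finset.prod_const, Finset.card_univ, Fintype.card_fin, ← rpow_mul_natCast pi_pos.le]
        congr 2
        ring
      · rw [← rpow_natCast, ← rpow_mul hnorm.le, Finset.sum_sub_distrib, hsdef]
        congr 1
        simp
        ring
    · intro k _
      positivity
    · intro k _
      exact mul_nonneg (by positivity) (hc0 k).le
  have hinner : ∀ x : EuclideanSpace ℝ (Fin n),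
      ∫⁻ x', ENNReal.ofReal (g x) * ENNReal.ofReal (g x') *
        ∏ k, ∫⁻ z, ENNReal.ofReal (‖z - x‖ ^ (α k / 2 - n)) *
          ENNReal.ofReal (‖z - x'‖ ^ (α k / 2 - n)) =
      ENNReal.ofReal (π ^ ((m : ℝ) * n / 2) * (∏ k, c k) *
          (π ^ ((n : ℝ) / 2) * (Gamma (n / 2 - s) / Gamma (n - s)))) *
        ENNReal.ofReal ((1 + ‖x‖ ^ 2) ^ (-(n : ℝ))) := by
    intro x
    calc _ = ∫⁻ x', ENNReal.ofReal (g x) * ENNReal.ofReal (π ^ ((m : ℝ) * n / 2) * ∏ k, c k) *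
          (ENNReal.ofReal ((‖x' - x‖ ^ 2) ^ (-s)) *
            ENNReal.ofReal ((1 + ‖x'‖ ^ 2) ^ (s - n))) := by
          refine lintegral_congr_ae ?_
          filter_upwards [Measure.ae_ne volume x] with x' hx'
          rw [hkernel x x' hx', hg' x']
          ring
      _ = _ := by
          have hx : 0 < 1 + ‖x‖ ^ 2 := by positivity
          rw [lintegral_const_mul' _ _
            (ENNReal.mul_ne_top ENNReal.ofReal_ne_top ENNReal.ofReal_ne_top),
            lintegral_norm_sub_rpow_mul_one_add_norm_sq_rpow hn hs hsn, hg',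
            ← ENNReal.ofReal_mul (by positivity), ← ENNReal.ofReal_mul (by positivity),
            ← ENNReal.ofReal_mul (by positivity), ← ENNReal.ofReal_mul (by positivity),
            show -(n : ℝ) = s - n + -s by ring, rpow_add hx]
          congr 1
          ring
  simp only [hinner]
  rw [lintegral_const_mul' _ _ ENNReal.ofReal_ne_top, hS, ← ENNReal.ofReal_mul (by positivity),
    hGα, hnq, hnp, show (n : ℝ) - s - n / 2 = n / 2 - s by ring,
    ← ENNReal.ofReal_mul (by positivity)]
  congr 1
  have hpi : (Gamma n / Gamma ((n : ℝ) / 2)) ^ (2 / p - 1) *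
      (π ^ ((n : ℝ) / 2) * (Gamma (n / 2) / Gamma n)) ^ (2 / p) =
      π ^ ((n : ℝ) / 2 - s) * (π ^ ((n : ℝ) / 2) * (Gamma (n / 2) / Gamma n)) := by
    have hS0 : 0 < π ^ ((n : ℝ) / 2) * (Gamma ((n : ℝ) / 2) / Gamma n) := by positivity
    rw [show (2 : ℝ) / p = 2 / p - 1 + 1 by ring, rpow_add hS0, rpow_one, ← mul_assoc,
      add_sub_cancel_right, ← mul_rpow (by positivity) hS0.le,
      show Gamma n / Gamma ((n : ℝ) / 2) * (π ^ ((n : ℝ) / 2) * (Gamma (n / 2) / Gamma n)) =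
        π ^ ((n : ℝ) / 2) by field_simp, ← rpow_mul pi_pos.le]
    congr 2
    rw [hp']
    field_simp
    ring
  rw [rpow_add pi_pos, mul_assoc _ _ (_ ^ (2 / p)), hpi, rpow_sub pi_pos]
  field_simp
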